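/- Let N be a positive integer, Λ = (n_1, …, n_N) a vector of distinct positive integers, and a_i = (a_{i,1}, …, a_{i,n_i}) ∈ ℂ^{n_i} arbitrary parameter vectors. Then the function u_Λ(x, y, t) = 2 ∂²/∂x² ln σ(x, y, t) is real-analytic and satisfies the KP-I equation (u_t + 6 u u_x + u_{xxx})_x − 3 u_{yy} = 0 at every point (x, y, t) ∈ ℝ³ where σ(x, y, t) ≠ 0. -/

import Mathlib

open scoped BigOperators
open Complex

noncomputable section

/-- Elementary Schur polynomial `S_k(x)` for a sequence `x = (x_1, x_2, …)`
(indexed so that `x j` is the `j`-th entry, `j ≥ 1`), defined by the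
generating-function identity `∑ S_k(x) ε^k = exp (∑_{n≥1} x_n ε^n)`;
explicitly, `S_k(x) = ∑_{partitions p of k} ∏_i x_i^{m_i(p)} / m_i(p)!`. -/
noncomputable def schurS (k : ℕ) (x : ℕ → ℂ) : ℂ :=
  ∑ p : Nat.Partition k,
    ∏ i ∈ p.parts.toFinset,
      x i ^ (p.parts.count i) / (Nat.factorial (p.parts.count i) : ℂ)

/-- `S_k` for integer index, with `S_k = 0` for `k < 0`. -/
noncomputable def schurZ (k : ℤ) (x : ℕ → ℂ) : ℂ :=
  if 0 ≤ k then schurS k.toNat x else 0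

/-- The sequence `x⁺`, with `x_k⁺ = x/k! + (2^k/k!) i y − 4 (3^k/k!) t`. -/
noncomputable def xplus (x y t : ℝ) (k : ℕ) : ℂ :=
  (x : ℂ) / (Nat.factorial k : ℂ)
    + (2 : ℂ) ^ k / (Nat.factorial k : ℂ) * Complex.I * (y : ℂ)
    - 4 * ((3 : ℂ) ^ k / (Nat.factorial k : ℂ)) * (t : ℂ)

/-- `s = (s_1, s_2, …)` is the sequence of Taylor coefficients at `α = 0` of
`ln((2/α) tanh(α/2))` (with `s 0 = 0`). -/
def IsSCoeffs (s : ℕ → ℝ) : Prop :=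
  s 0 = 0 ∧ ∃ ε > (0 : ℝ), ∀ α : ℝ, α ≠ 0 → |α| < ε →
    HasSum (fun j : ℕ => s j * α ^ j) (Real.log (2 / α * Real.tanh (α / 2)))

/-- The tau function `σ(x,y,t)` of the higher-order lump with index vector
`Λ = (n 0, …, n (N-1))` and internal parameters `a`. -/
noncomputable def tau (N : ℕ) (n : Fin N → ℕ) (a : Fin N → ℕ → ℂ) (s : ℕ → ℝ)
    (x y t : ℝ) : ℂ :=
  Matrix.det (Matrix.of fun i j : Fin N =>
    ∑ ν ∈ Finset.range (min (n i) (n j) + 1),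
      ((4 : ℂ)⁻¹) ^ ν
        * schurS (n i - ν) (fun k => xplus x y t k + (ν : ℂ) * (s k : ℂ) + a i k)
        * schurS (n j - ν) (fun k =>
            (starRingEnd ℂ) (xplus x y t k) + (ν : ℂ) * (s k : ℂ)
              + (starRingEnd ℂ) (a j k)))

/-- The higher-order lump `u_Λ = 2 ∂²/∂x² ln σ`. -/
noncomputable def uLam (N : ℕ) (n : Fin N → ℕ) (a : Fin N → ℕ → ℂ) (s : ℕ → ℝ)
    (x y t : ℝ) : ℝ :=
  (2 * iteratedDeriv 2 (fun x' : ℝ => Complex.log (tau N n a s x' y t)) x).re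

/-- The fundamental lump. -/
noncomputable def u1 (x y t : ℝ) : ℝ :=
  16 * (1 - 4 * (x - 12 * t) ^ 2 + 16 * y ^ 2)
    / (1 + 4 * (x - 12 * t) ^ 2 + 16 * y ^ 2) ^ 2

/-- Partial derivative in the first (x) variable. -/
noncomputable def pdx (f : ℝ → ℝ → ℝ → ℝ) : ℝ → ℝ → ℝ → ℝ :=
  fun x y t => deriv (fun x' => f x' y t) x

/-- Partial derivative in the second (y) variable. -/
noncomputable def pdy (f : ℝ → ℝ → ℝ → ℝ) : ℝ → ℝ → ℝ → ℝ :=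
  fun x y t => deriv (fun y' => f x y' t) y

/-- Partial derivative in the third (t) variable. -/
noncomputable def pdt (f : ℝ → ℝ → ℝ → ℝ) : ℝ → ℝ → ℝ → ℝ :=
  fun x y t => deriv (fun t' => f x y t') t

/-- `u` satisfies the KP-I equation `(u_t + 6 u u_x + u_{xxx})_x − 3 u_{yy} = 0`
at the point `(x, y, t)`. -/
def IsKPISolutionAt (u : ℝ → ℝ → ℝ → ℝ) (x y t : ℝ) : Prop :=
  pdx (fun x y t => pdt u x y t + 6 * u x y t * pdx u x y t + pdx (pdx (pdx u)) x y t) x y t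
    - 3 * pdy (pdy u) x y t = 0

end

section
open PowerSeries in
noncomputable def SS (w : ℕ → ℂ) : PowerSeries ℂ := PowerSeries.mk fun k => schurS k w

theorem SS_eq_genFun (w : ℕ → ℂ) :
    SS w = Nat.Partition.genFun (fun i m => w i ^ m / (Nat.factorial m : ℂ)) := by
  ext k
  simp only [SS, PowerSeries.coeff_mk, Nat.Partition.coeff_genFun, schurS, Finsupp.prod,
    Multiset.toFinsupp_support, Multiset.toFinsupp_apply]

open scoped PowerSeries.WithPiTopology in
theorem factor_eq (a : ℂ) (i : ℕ) :
    (1 + ∑' j : ℕ, (a ^ (j + 1) / (Nat.factorial (j + 1) : ℂ)) •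
      (PowerSeries.X : PowerSeries ℂ) ^ ((i + 1) * (j + 1)))
    = PowerSeries.expand (i + 1) (Nat.succ_ne_zero i) (PowerSeries.rescale a (PowerSeries.exp ℂ)) := by
  have hs := Nat.Partition.summable_genFun_term (R := ℂ)
    (fun _ m => a ^ m / (Nat.factorial m : ℂ)) i
  ext d
  rw [map_add, hs.map_tsum _ (PowerSeries.WithPiTopology.continuous_coeff _ _)]
  by_cases hd : (i + 1) ∣ d
  · obtain ⟨m, rfl⟩ := hd
    rw [PowerSeries.coeff_expand_mul]
    rcases m with _ | m
    · have : ∀ j : ℕ, ¬ (0 = (i+1) * (j+1)) := by intro j; positivity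
      simp [PowerSeries.coeff_X_pow, PowerSeries.coeff_one, this]
    · rw [tsum_eq_single m]
      · simp [PowerSeries.coeff_X_pow, PowerSeries.coeff_one, div_eq_mul_inv]
      · intro b hb
        have : ¬ m = b := fun h => hb h.symm
        simp [PowerSeries.coeff_X_pow, this]
  · rw [PowerSeries.coeff_expand_of_not_dvd _ _ _ hd]
    have h0 : d ≠ 0 := by rintro rfl; simp at hd
    have : ∀ j : ℕ, ¬ (d = (i+1) * (j+1)) := by rintro j rfl; simp at hd
    simp [PowerSeries.coeff_X_pow, PowerSeries.coeff_one, this, h0]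

theorem SS_add (w v : ℕ → ℂ) : SS (fun k => w k + v k) = SS w * SS v := by
  let _ : TopologicalSpace (PowerSeries ℂ) := PowerSeries.WithPiTopology.instTopologicalSpace ℂ
  have _ : T2Space (PowerSeries ℂ) := PowerSeries.WithPiTopology.instT2Space ℂ
  have _ : IsTopologicalSemiring (PowerSeries ℂ) := PowerSeries.WithPiTopology.instIsTopologicalSemiring ℂ
  have H : ∀ u : ℕ → ℂ, HasProd (fun i => PowerSeries.expand (i + 1) (Nat.succ_ne_zero i)
      (PowerSeries.rescale (u (i+1)) (PowerSeries.exp ℂ))) (SS u) := by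
    intro u
    rw [SS_eq_genFun]
    have := Nat.Partition.hasProd_genFun (R := ℂ) (fun i m => u i ^ m / (Nat.factorial m : ℂ))
    simpa only [factor_eq] using this
  have h1 := (H w).mul (H v)
  have h2 := H (fun k => w k + v k)
  refine h2.unique ?_
  convert h1 using 2 with i
  rw [← map_mul, PowerSeries.exp_mul_exp_eq_exp_add]

theorem schurS_zero (w : ℕ → ℂ) : schurS 0 w = 1 := by
  simp [schurS, Finset.univ_unique]

theorem schurS_deriv_zero (k : ℕ) (hk : k ≠ 0) (w : ℝ → ℕ → ℂ) (v : ℕ → ℂ) (r : ℝ)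
    (h0 : ∀ j, w r j = 0) (hw : ∀ j, HasDerivAt (fun q => w q j) (v j) r) :
    HasDerivAt (fun q => schurS k (w q)) (v k) r := by
  unfold schurS
  have key : ∀ p : Nat.Partition k, HasDerivAt (fun q => ∏ i ∈ p.parts.toFinset,
      w q i ^ (p.parts.count i) / (Nat.factorial (p.parts.count i) : ℂ))
      (if p = Nat.Partition.indiscrete k then v k else 0) r := by
    intro p
    have hd := HasDerivAt.finsetProd (u := p.parts.toFinset)
      (f := fun i q => w q i ^ (p.parts.count i) / (Nat.factorial (p.parts.count i) : ℂ))
      (f' := fun i => ((p.parts.count i : ℂ) * w r i ^ (p.parts.count i - 1) * v i) /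
        (Nat.factorial (p.parts.count i) : ℂ)) (x := r)
      (fun i _ => by
        exact ((hw i).pow (p.parts.count i)).div_const _)
    convert! hd using 1
    · ext q; simp
    symm
    split_ifs with hp
    · subst hp
      have : (Nat.Partition.indiscrete k).parts = {k} := by simp [hk]
      rw [this]
      simp
    · apply Finset.sum_eq_zero
      intro i hi
      by_cases hc : p.parts.count i = 1
      · have : ∃ j ∈ p.parts.toFinset, j ≠ i := by
          by_contra hcon
          push Not at hcon
          apply hp
          have : p.parts = {i} := by
            have hr : p.parts = Multiset.replicate (Multiset.card p.parts) i :=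
              Multiset.eq_replicate.2 ⟨rfl, fun b hb => hcon b (by simpa using hb)⟩
            rw [hr] at hc
            simp only [Multiset.count_replicate_self] at hc
            rw [hr, hc]; simp
          ext1
          have h2 := p.parts_sum
          rw [this] at h2 ⊢
          simp at h2
          subst h2
          simp [hk]
        obtain ⟨j, hj, hji⟩ := this
        rw [Finset.prod_eq_zero (i := j)]
        · simp
        · simp [hji] ; simpa using hj
        · have : p.parts.count j ≠ 0 := by
            rw [Multiset.count_ne_zero]; simpa using hj
          simp [h0, this]
      · have : p.parts.count i ≠ 0 := by
            rw [Multiset.count_ne_zero]; simpa using hi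
        have : p.parts.count i - 1 ≠ 0 := by omega
        simp [h0, this]
  have := HasDerivAt.fun_sum (u := Finset.univ) (fun p _ => key p)
  simpa using this

/-- derivative of a coefficient of `f * SS w`. -/
theorem SS_hasDerivAt (n : ℕ) (f V : PowerSeries ℂ) (w : ℝ → ℕ → ℂ) (r : ℝ)
    (hV0 : PowerSeries.coeff 0 V = 0)
    (hw : ∀ j, j ≠ 0 → HasDerivAt (fun q => w q j) (PowerSeries.coeff j V) r)
    (hw0 : ∀ q, w q 0 = w r 0) :
    HasDerivAt (fun q => PowerSeries.coeff n (f * SS (w q)))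
      (PowerSeries.coeff n (f * V * SS (w r))) r := by
  have hw' : ∀ j, HasDerivAt (fun q => w q j) (PowerSeries.coeff j V) r := by
    intro j
    by_cases hj : j = 0
    · subst hj; rw [hV0, show (fun q => w q 0) = fun _ => w r 0 from funext hw0]
      exact hasDerivAt_const _ _
    · exact hw j hj
  have hdiff : ∀ k, HasDerivAt (fun q => PowerSeries.coeff k (SS (fun j => w q j - w r j)))
      (PowerSeries.coeff k V) r := by
    intro k
    by_cases hk : k = 0
    · subst hk
      simp only [SS, PowerSeries.coeff_mk, schurS_zero, hV0]
      exact hasDerivAt_const _ _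
    · simp only [SS, PowerSeries.coeff_mk]
      exact schurS_deriv_zero k hk (fun q j => w q j - w r j) _ r (by simp)
        (fun j => (hw' j).sub_const _)
  have e : ∀ q, f * SS (w q) = (f * SS (w r)) * SS (fun j => w q j - w r j) := by
    intro q
    rw [mul_assoc, ← SS_add]
    congr 2
    ext j; ring
  rw [show (fun q => PowerSeries.coeff n (f * SS (w q))) = fun q => PowerSeries.coeff n
    ((f * SS (w r)) * SS (fun j => w q j - w r j)) from funext fun q => by rw [e q]]
  rw [show f * V * SS (w r) = f * SS (w r) * V by ring]
  simp only [PowerSeries.coeff_mul n (f * SS (w r))]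
  exact HasDerivAt.fun_sum (fun i _ => (hdiff i.2).const_mul _)

end

section
theorem schurS_scale (k : ℕ) (q : ℂ) (w : ℕ → ℂ) :
    schurS k (fun j => q ^ j * w j) = q ^ k * schurS k w := by
  unfold schurS
  rw [Finset.mul_sum]
  refine Finset.sum_congr rfl fun p _ => ?_
  have h : q ^ k = ∏ i ∈ p.parts.toFinset, (q ^ i) ^ (p.parts.count i) := by
    conv_lhs => rw [← p.parts_sum, Finset.sum_multiset_count, ← Finset.prod_pow_eq_pow_sum]
    refine Finset.prod_congr rfl fun i _ => ?_
    rw [smul_eq_mul, mul_comm, pow_mul]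
  rw [h, ← Finset.prod_mul_distrib]
  refine Finset.prod_congr rfl fun i _ => ?_
  rw [mul_pow, mul_div_assoc]

theorem SS_derivative (w : ℕ → ℂ) :
    PowerSeries.derivative ℂ (SS w) = PowerSeries.derivative ℂ (PowerSeries.mk w) * SS w := by
  have hX : (PowerSeries.X : PowerSeries ℂ) ≠ 0 := PowerSeries.X_ne_zero
  apply mul_left_cancel₀ hX
  rw [← mul_assoc]
  ext n
  have h := SS_hasDerivAt n 1 (PowerSeries.X * PowerSeries.derivative ℂ (PowerSeries.mk w))
    (fun q j => (q : ℂ) ^ j * w j) 1 (by simp) (by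
      intro j hj
      obtain ⟨j, rfl⟩ := Nat.exists_eq_succ_of_ne_zero hj
      rw [Nat.succ_eq_add_one, PowerSeries.coeff_succ_X_mul, PowerSeries.coeff_derivative, PowerSeries.coeff_mk]
      have := ((hasDerivAt_id (1:ℝ)).ofReal_comp.pow (j+1)).mul_const (w (j+1))
      convert! this using 1
      simp; ring) (by intro q; simp)
  simp only [one_mul, ofReal_one, one_pow] at h
  have h2 : HasDerivAt (fun q : ℝ => PowerSeries.coeff n (SS fun j => (q : ℂ) ^ j * w j))
      (n * schurS n w) 1 := by
    simp only [SS, PowerSeries.coeff_mk, schurS_scale]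
    have := ((hasDerivAt_id (1:ℝ)).ofReal_comp.pow n).mul_const (schurS n w)
    convert! this using 1
    simp
  refine Eq.trans ?_ (h2.unique h)
  rcases n with _ | n
  · simp
  · rw [PowerSeries.coeff_succ_X_mul, PowerSeries.coeff_derivative]
    simp only [SS, PowerSeries.coeff_mk]; push_cast; ring

theorem ode_unique (g A B : PowerSeries ℂ) (hA : PowerSeries.derivative ℂ A = g * A)
    (hB : PowerSeries.derivative ℂ B = g * B) (h0 : PowerSeries.coeff 0 A = PowerSeries.coeff 0 B) :
    A = B := by
  ext n
  induction n using Nat.strong_induction_on with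
  | _ n ih =>
    rcases n with _ | n
    · exact h0
    · have a := congrArg (PowerSeries.coeff n) hA
      have b := congrArg (PowerSeries.coeff n) hB
      rw [PowerSeries.coeff_derivative, PowerSeries.coeff_mul] at a b
      have : ∑ p ∈ Finset.HasAntidiagonal.antidiagonal n, PowerSeries.coeff p.1 g * PowerSeries.coeff p.2 A =
          ∑ p ∈ Finset.HasAntidiagonal.antidiagonal n, PowerSeries.coeff p.1 g * PowerSeries.coeff p.2 B := by
        refine Finset.sum_congr rfl fun p hp => ?_
        rw [ih p.2 (by have := Finset.HasAntidiagonal.mem_antidiagonal.1 hp; omega)]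
      rw [this, ← b] at a
      exact mul_right_cancel₀ (by exact_mod_cast Nat.succ_ne_zero n) a

/-- Formal Taylor series at zero. -/
noncomputable def tay (g : ℝ → ℝ) : PowerSeries ℝ :=
  PowerSeries.mk fun k => iteratedDeriv k g 0 / (Nat.factorial k : ℝ)

theorem tay_congr {f g : ℝ → ℝ} (h : f =ᶠ[nhds 0] g) : tay f = tay g := by
  ext k; simp only [tay, PowerSeries.coeff_mk]; rw [h.iteratedDeriv_eq]

theorem tay_mul {f g : ℝ → ℝ} (hf : AnalyticAt ℝ f 0) (hg : AnalyticAt ℝ g 0) :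
    tay (fun x => f x * g x) = tay f * tay g := by
  ext k
  rw [PowerSeries.coeff_mul]
  simp only [tay, PowerSeries.coeff_mk]
  rw [iteratedDeriv_fun_mul hf.contDiffAt hg.contDiffAt, Finset.Nat.sum_antidiagonal_eq_sum_range_succ_mk,
    Finset.sum_div]
  refine Finset.sum_congr rfl fun i hi => ?_
  have hi : i ≤ k := by simpa [Nat.lt_succ_iff] using hi
  rw [Nat.cast_choose ℝ hi]
  have := Nat.factorial_ne_zero k
  field_simp

theorem tay_add {f g : ℝ → ℝ} (hf : AnalyticAt ℝ f 0) (hg : AnalyticAt ℝ g 0) :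
    tay (fun x => f x + g x) = tay f + tay g := by
  ext k
  simp only [tay, PowerSeries.coeff_mk, map_add]
  rw [iteratedDeriv_fun_add hf.contDiffAt hg.contDiffAt, add_div]

theorem tay_deriv (f : ℝ → ℝ) : tay (deriv f) = PowerSeries.derivative ℝ (tay f) := by
  ext k
  rw [PowerSeries.coeff_derivative]
  simp only [tay, PowerSeries.coeff_mk]
  rw [iteratedDeriv_succ', Nat.factorial_succ]
  push_cast
  field_simp

theorem tay_const (c : ℝ) : tay (fun _ => c) = PowerSeries.C c := by
  ext k
  simp only [tay, PowerSeries.coeff_mk, PowerSeries.coeff_C, iteratedDeriv_const]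
  split_ifs with h <;> simp [h]

theorem tay_id : tay (fun x => x) = PowerSeries.X := by
  ext k
  simp only [tay, PowerSeries.coeff_mk, PowerSeries.coeff_X, iteratedDeriv_fun_id_zero]
  split_ifs with h <;> simp [h]

theorem tay_exp : tay Real.exp = PowerSeries.exp ℝ := by
  ext k
  simp [tay, iteratedDeriv_eq_iterate]

theorem tay_series (s : ℕ → ℝ) (f : ℝ → ℝ) (h : ∀ᶠ z in nhds (0:ℝ), HasSum (fun j => s j * z ^ j) (f z)) :
    AnalyticAt ℝ f 0 ∧ tay f = PowerSeries.mk s := by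
  have H : HasFPowerSeriesAt f (FormalMultilinearSeries.ofScalars ℝ s) 0 := by
    rw [hasFPowerSeriesAt_iff]
    filter_upwards [h] with z hz
    simpa [FormalMultilinearSeries.coeff_ofScalars, mul_comm] using hz
  refine ⟨H.analyticAt, ?_⟩
  have H2 := H.analyticAt.hasFPowerSeriesAt
  have := H.eq_formalMultilinearSeries H2
  ext k
  have := congrArg (fun p => p.coeff k) this
  simp only [FormalMultilinearSeries.coeff_ofScalars] at this
  simp [tay, this]

theorem tanh_aux (α : ℝ) : Real.tanh (α / 2) * (Real.exp α + 1) = Real.exp α - 1 := by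
  have h : Real.exp α = Real.exp (α/2) * Real.exp (α/2) := by rw [← Real.exp_add]; ring_nf
  rw [Real.tanh_eq_sinh_div_cosh, Real.sinh_eq, Real.cosh_eq, h, Real.exp_neg]
  have := Real.exp_pos (α/2)
  field_simp

theorem tanh_pos_aux (α : ℝ) (h : α ≠ 0) : 0 < 2 / α * Real.tanh (α / 2) := by
  have h1 := tanh_aux α
  have h2 := Real.exp_pos α
  rcases lt_or_gt_of_ne h with h | h
  · have h3 : Real.exp α < 1 := by simpa using h
    have : Real.tanh (α/2) < 0 := by
      by_contra hc
      have := mul_nonneg (not_lt.1 hc) (by linarith : 0 ≤ Real.exp α + 1)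
      linarith
    exact mul_pos_of_neg_of_neg (div_neg_of_pos_of_neg two_pos h) this
  · have h3 : 1 < Real.exp α := Real.one_lt_exp_iff.2 h
    have : 0 < Real.tanh (α/2) := by
      by_contra hc
      have := mul_nonneg (neg_nonneg.2 (not_lt.1 hc)) (by linarith : 0 ≤ Real.exp α + 1)
      linarith
    exact mul_pos (div_pos two_pos h) this

theorem SS_tanh (s : ℕ → ℝ) (hs : IsSCoeffs s) :
    PowerSeries.X * SS (fun k => (s k : ℂ)) * (PowerSeries.exp ℂ + 1)
      = 2 * (PowerSeries.exp ℂ - 1) := by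
  obtain ⟨h0, ε, hε, hsum⟩ := hs
  set f : ℝ → ℝ := fun α => if α = 0 then 0 else Real.log (2 / α * Real.tanh (α / 2)) with hf
  have hfs : ∀ᶠ z in nhds (0:ℝ), HasSum (fun j => s j * z ^ j) (f z) := by
    filter_upwards [Metric.ball_mem_nhds (0:ℝ) hε] with z hz
    by_cases hz0 : z = 0
    · subst hz0
      simp only [hf, if_true]
      have : (fun j => s j * (0:ℝ) ^ j) = fun _ => 0 := by
        ext j; rcases j with _ | j <;> simp [h0]
      rw [this]; exact hasSum_zero
    · simp only [hf, if_neg hz0]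
      exact hsum z hz0 (by simpa using hz)
  obtain ⟨hfa, hft⟩ := tay_series s f hfs
  have hexpa : AnalyticAt ℝ Real.exp 0 := analyticAt_rexp
  set F : ℝ → ℝ := fun α => Real.exp (f α) with hF
  have hFa : AnalyticAt ℝ F 0 := hfa.rexp
  have hrel : ∀ α, α * F α * (Real.exp α + 1) = 2 * (Real.exp α + (-1)) := by
    intro α
    by_cases hα : α = 0
    · simp [hα]
    · simp only [hF, hf, if_neg hα]
      rw [Real.exp_log (tanh_pos_aux α hα), ← sub_eq_add_neg, ← tanh_aux]
      field_simp
  have hR : PowerSeries.X * tay F * (PowerSeries.exp ℝ + PowerSeries.C 1) =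
      PowerSeries.C 2 * (PowerSeries.exp ℝ + PowerSeries.C (-1)) := by
    have hid : AnalyticAt ℝ (fun x : ℝ => x) 0 := analyticAt_id
    rw [← tay_id, ← tay_exp, ← tay_const, ← tay_const, ← tay_const, ← tay_mul hid hFa,
      ← tay_add hexpa analyticAt_const, ← tay_add hexpa analyticAt_const,
      ← tay_mul (hid.fun_mul hFa) (hexpa.fun_add analyticAt_const),
      ← tay_mul analyticAt_const (hexpa.fun_add analyticAt_const)]
    congr 1
    funext α; exact hrel α
  have hode : PowerSeries.derivative ℝ (tay F) = PowerSeries.derivative ℝ (PowerSeries.mk s) * tay F := by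
    rw [← hft, ← tay_deriv, ← tay_deriv, ← tay_mul hfa.deriv hFa]
    apply tay_congr
    filter_upwards [hfa.eventually_analyticAt] with z hz
    rw [hz.differentiableAt.hasDerivAt.exp.deriv, mul_comm]
  have hc0 : PowerSeries.coeff 0 (tay F) = 1 := by simp [tay, hF, hf]
  have hmap : PowerSeries.map (algebraMap ℝ ℂ) (tay F) = SS (fun k => (s k : ℂ)) := by
    apply ode_unique (PowerSeries.derivative ℂ (PowerSeries.mk fun k => (s k : ℂ)))
    · have := congrArg (PowerSeries.map (algebraMap ℝ ℂ)) hode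
      rw [map_mul] at this
      convert this using 1
      · ext k; simp [PowerSeries.coeff_derivative]
      · congr 1; ext k; simp [PowerSeries.coeff_derivative]
    · exact SS_derivative _
    · rw [PowerSeries.coeff_map, hc0]; simp [SS, schurS_zero]
  have := congrArg (PowerSeries.map (algebraMap ℝ ℂ)) hR
  simp only [map_mul, map_add, hmap, PowerSeries.map_X, PowerSeries.map_exp, PowerSeries.map_C] at this
  simp only [map_one, map_neg] at this
  have h2 : (PowerSeries.C ((algebraMap ℝ ℂ) 2) : PowerSeries ℂ) = 2 := by
    rw [map_ofNat, map_ofNat]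
  rw [this, sub_eq_add_neg, h2]

end

section

/-- bilinear sum -/
noncomputable def BB (T : PowerSeries ℂ) (K n m : ℕ) (G H f g : PowerSeries ℂ) : ℂ :=
  ∑ ν ∈ Finset.range K, PowerSeries.coeff n (f * T ^ ν * G) * PowerSeries.coeff m (g * T ^ ν * H)

theorem BB_rel (T P : PowerSeries ℂ) (K n m : ℕ) (G H f g : PowerSeries ℂ)
    (hT : PowerSeries.X ∣ T) (hP : (P + 1) * T = P - 1) (hK : n < K) :
    BB T K n m G H (P * f) g + BB T K n m G H f (P * g) =
      1 / 2 * PowerSeries.coeff n ((P + 1) * f * G) * PowerSeries.coeff m ((P + 1) * g * H) := by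
  set a : ℕ → ℂ := fun ν => PowerSeries.coeff n ((P + 1) * f * T ^ ν * G) with ha
  set b : ℕ → ℂ := fun ν => PowerSeries.coeff m ((P + 1) * g * T ^ ν * H) with hb
  have haK : a K = 0 := by
    simp only [ha]
    have : PowerSeries.X ^ K ∣ (P + 1) * f * T ^ K * G :=
      Dvd.dvd.mul_right (Dvd.dvd.mul_left (pow_dvd_pow_of_dvd hT K) _) _
    exact PowerSeries.X_pow_dvd_iff.1 this n hK
  have two : ∀ (k : ℕ) (F : PowerSeries ℂ), PowerSeries.coeff k (F + F) = 2 * PowerSeries.coeff k F := by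
    intro k F; rw [map_add]; ring
  have a1 : ∀ ν, a ν + a (ν+1) = 2 * PowerSeries.coeff n (P * f * T ^ ν * G) := by
    intro ν
    simp only [ha]
    rw [← map_add, ← two]
    congr 1
    linear_combination (f * T ^ ν * G) * hP
  have a2 : ∀ ν, a ν - a (ν+1) = 2 * PowerSeries.coeff n (f * T ^ ν * G) := by
    intro ν
    simp only [ha]
    rw [← map_sub, ← two]
    congr 1
    linear_combination -(f * T ^ ν * G) * hP
  have b1 : ∀ ν, b ν + b (ν+1) = 2 * PowerSeries.coeff m (P * g * T ^ ν * H) := by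
    intro ν
    simp only [hb]
    rw [← map_add, ← two]
    congr 1
    linear_combination (g * T ^ ν * H) * hP
  have b2 : ∀ ν, b ν - b (ν+1) = 2 * PowerSeries.coeff m (g * T ^ ν * H) := by
    intro ν
    simp only [hb]
    rw [← map_sub, ← two]
    congr 1
    linear_combination -(g * T ^ ν * H) * hP
  unfold BB
  rw [← Finset.sum_add_distrib]
  have : ∀ ν, PowerSeries.coeff n (P * f * T ^ ν * G) * PowerSeries.coeff m (g * T ^ ν * H) +
      PowerSeries.coeff n (f * T ^ ν * G) * PowerSeries.coeff m (P * g * T ^ ν * H)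
      = 1 / 2 * (a ν * b ν) - 1 / 2 * (a (ν+1) * b (ν+1)) := by
    intro ν
    linear_combination -(1/2) * PowerSeries.coeff m (g * T ^ ν * H) * a1 ν
      - (1/4) * (a ν + a (ν+1)) * b2 ν
      - (1/2) * PowerSeries.coeff m (P * g * T ^ ν * H) * a2 ν - 1/4 * (a ν - a (ν+1)) * b1 ν
  simp_rw [this]
  rw [Finset.sum_range_sub' (fun ν => 1 / 2 * (a ν * b ν)), haK]
  simp [ha, hb]; ring

noncomputable def EE : PowerSeries ℂ := PowerSeries.exp ℂ
/-- formal tanh(X/2) -/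
noncomputable def TT (s : ℕ → ℝ) : PowerSeries ℂ :=
  PowerSeries.C (1/2) * (PowerSeries.X * SS (fun k => (s k : ℂ)))
theorem TT_dvd (s : ℕ → ℝ) : PowerSeries.X ∣ TT s :=
  Dvd.dvd.mul_left (Dvd.dvd.mul_right dvd_rfl _) _
theorem TT_rel (s : ℕ → ℝ) (hs : IsSCoeffs s) : (EE + 1) * TT s = EE - 1 := by
  have h := SS_tanh s hs
  unfold TT EE
  have h2 : (PowerSeries.C (1/2 : ℂ)) * 2 = 1 := by
    rw [← map_ofNat (PowerSeries.C (R := ℂ)), ← map_mul]; norm_num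
  linear_combination PowerSeries.C (1/2 : ℂ) * h + (PowerSeries.exp ℂ - 1) * h2

theorem SS_zero : SS (fun _ => 0) = 1 := by
  have h := SS_add (fun _ => 0) (fun _ => 0)
  simp only [add_zero] at h
  have h1 : SS (fun _ => 0) ≠ 0 := by
    intro h0
    have := congrArg (PowerSeries.coeff 0) h0
    simp [SS, schurS_zero] at this
  have := mul_left_cancel₀ h1 (h.symm.trans (mul_one _).symm)
  exact this

theorem SS_pow (w : ℕ → ℂ) (ν : ℕ) : SS w ^ ν = SS (fun k => (ν : ℂ) * w k) := by
  induction ν with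
  | zero => simp [SS_zero]
  | succ ν ih =>
    rw [pow_succ, ih, ← SS_add]
    congr 1; ext k; push_cast; ring

theorem coeff_TT (s : ℕ → ℝ) (ν n : ℕ) (w : ℕ → ℂ) :
    PowerSeries.coeff n (TT s ^ ν * SS w) =
      if ν ≤ n then (1/2 : ℂ) ^ ν * schurS (n - ν) (fun k => w k + (ν : ℂ) * s k) else 0 := by
  have : TT s ^ ν * SS w = PowerSeries.C ((1/2 : ℂ) ^ ν) *
      (PowerSeries.X ^ ν * SS (fun k => w k + (ν : ℂ) * s k)) := by
    rw [SS_add, ← SS_pow]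
    unfold TT
    rw [map_pow]
    ring
  rw [this, PowerSeries.coeff_C_mul, PowerSeries.coeff_X_pow_mul']
  split_ifs <;> simp [SS]

section
variable (x y t : ℝ) (a : ℕ → ℂ)

noncomputable def GG (x y t : ℝ) (a : ℕ → ℂ) : PowerSeries ℂ := SS (fun k => xplus x y t k + a k)
noncomputable def HH (x y t : ℝ) (a : ℕ → ℂ) : PowerSeries ℂ :=
  SS (fun k => (starRingEnd ℂ) (xplus x y t k) + (starRingEnd ℂ) (a k))

theorem schurS_congr (k : ℕ) (v w : ℕ → ℂ) (h : ∀ j, j ≠ 0 → v j = w j) : schurS k v = schurS k w := by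
  unfold schurS
  refine Finset.sum_congr rfl fun p _ => Finset.prod_congr rfl fun i hi => ?_
  rw [h i]
  exact (p.parts_pos (by simpa using hi)).ne'

theorem SS_congr (v w : ℕ → ℂ) (h : ∀ j, j ≠ 0 → v j = w j) : SS v = SS w := by
  ext k; simp only [SS, PowerSeries.coeff_mk]; exact schurS_congr k v w h

theorem EE_pow (k j : ℕ) : PowerSeries.coeff j (EE ^ k) = (k : ℂ) ^ j / (Nat.factorial j : ℂ) := by
  unfold EE
  rw [PowerSeries.exp_pow_eq_rescale_exp]
  simp [div_eq_mul_inv]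

/-- variant without condition at the zero index -/
theorem SS_hasDerivAt' (n : ℕ) (f V : PowerSeries ℂ) (w : ℝ → ℕ → ℂ) (r : ℝ)
    (hV0 : PowerSeries.coeff 0 V = 0)
    (hw : ∀ j, j ≠ 0 → HasDerivAt (fun q => w q j) (PowerSeries.coeff j V) r) :
    HasDerivAt (fun q => PowerSeries.coeff n (f * SS (w q)))
      (PowerSeries.coeff n (f * V * SS (w r))) r := by
  have h := SS_hasDerivAt n f V (fun q j => if j = 0 then 0 else w q j) r hV0 (by
    intro j hj; simpa [hj] using hw j hj) (by simp)
  have e : ∀ q, SS (fun j => if j = 0 then 0 else w q j) = SS (w q) := fun q =>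
    SS_congr _ _ (by intro j hj; simp [hj])
  simpa only [e] using h

theorem xplus_x (j : ℕ) : HasDerivAt (fun q => xplus q y t j) (1 / (Nat.factorial j : ℂ)) x := by
  unfold xplus
  have := (((hasDerivAt_id x).ofReal_comp.div_const (Nat.factorial j : ℂ)).add_const
    ((2 : ℂ) ^ j / (Nat.factorial j : ℂ) * Complex.I * (y : ℂ))).sub_const
    (4 * ((3 : ℂ) ^ j / (Nat.factorial j : ℂ)) * (t : ℂ))
  simpa using this

theorem xplus_y (j : ℕ) : HasDerivAt (fun q => xplus x q t j) (I * ((2:ℂ) ^ j / (Nat.factorial j : ℂ))) y := by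
  unfold xplus
  have := (((hasDerivAt_id y).ofReal_comp.const_mul
    ((2 : ℂ) ^ j / (Nat.factorial j : ℂ) * Complex.I)).const_add ((x : ℂ) / (Nat.factorial j : ℂ))).sub_const
    (4 * ((3 : ℂ) ^ j / (Nat.factorial j : ℂ)) * (t : ℂ))
  convert! this using 1
  simp; ring

theorem xplus_t (j : ℕ) : HasDerivAt (fun q => xplus x y q j) (-4 * ((3:ℂ) ^ j / (Nat.factorial j : ℂ))) t := by
  unfold xplus
  have := (((hasDerivAt_id t).ofReal_comp.const_mul
    (4 * ((3 : ℂ) ^ j / (Nat.factorial j : ℂ)))).const_sub ((x : ℂ) / (Nat.factorial j : ℂ) +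
    ((2 : ℂ) ^ j / (Nat.factorial j : ℂ) * Complex.I * y)))
  convert! this using 1
  simp

theorem hasDerivAt_conj {f : ℝ → ℂ} {f' : ℂ} {r : ℝ} (h : HasDerivAt f f' r) :
    HasDerivAt (fun q => (starRingEnd ℂ) (f q)) ((starRingEnd ℂ) f') r :=
  (Complex.conjCLE.toContinuousLinearMap.hasFDerivAt).comp_hasDerivAt r h

theorem GG_x (n : ℕ) (f : PowerSeries ℂ) :
    HasDerivAt (fun q => PowerSeries.coeff n (f * GG q y t a))
      (PowerSeries.coeff n (f * (EE - 1) * GG x y t a)) x := by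
  apply SS_hasDerivAt' n f _ (fun q k => xplus q y t k + a k)
  · simp [EE]
  · intro j hj
    have h := (xplus_x x y t j).add_const (a j)
    convert! h using 1
    have := EE_pow 1 j
    simp only [pow_one] at this
    simp [this, PowerSeries.coeff_one, hj]

theorem HH_x (n : ℕ) (f : PowerSeries ℂ) :
    HasDerivAt (fun q => PowerSeries.coeff n (f * HH q y t a))
      (PowerSeries.coeff n (f * (EE - 1) * HH x y t a)) x := by
  apply SS_hasDerivAt' n f _ (fun q k => (starRingEnd ℂ) (xplus q y t k) + (starRingEnd ℂ) (a k))
  · simp [EE]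
  · intro j hj
    have h := (hasDerivAt_conj (xplus_x x y t j)).add_const ((starRingEnd ℂ) (a j))
    convert! h using 1
    have := EE_pow 1 j
    simp only [pow_one] at this
    simp [this, PowerSeries.coeff_one, hj]

theorem GG_y (n : ℕ) (f : PowerSeries ℂ) :
    HasDerivAt (fun q => PowerSeries.coeff n (f * GG x q t a))
      (PowerSeries.coeff n (f * (PowerSeries.C I * (EE ^ 2 - 1)) * GG x y t a)) y := by
  apply SS_hasDerivAt' n f _ (fun q k => xplus x q t k + a k)
  · simp [EE]
  · intro j hj
    have h := (xplus_y x y t j).add_const (a j)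
    convert! h using 1
    rw [PowerSeries.coeff_C_mul, map_sub, EE_pow]
    simp [PowerSeries.coeff_one, hj]

theorem HH_y (n : ℕ) (f : PowerSeries ℂ) :
    HasDerivAt (fun q => PowerSeries.coeff n (f * HH x q t a))
      (PowerSeries.coeff n (f * (PowerSeries.C (-I) * (EE ^ 2 - 1)) * HH x y t a)) y := by
  apply SS_hasDerivAt' n f _ (fun q k => (starRingEnd ℂ) (xplus x q t k) + (starRingEnd ℂ) (a k))
  · simp [EE]
  · intro j hj
    have h := (hasDerivAt_conj (xplus_y x y t j)).add_const ((starRingEnd ℂ) (a j))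
    convert! h using 1
    rw [PowerSeries.coeff_C_mul, map_sub, EE_pow]
    simp [PowerSeries.coeff_one, hj]
    simp only [map_ofNat]

theorem GG_t (n : ℕ) (f : PowerSeries ℂ) :
    HasDerivAt (fun q => PowerSeries.coeff n (f * GG x y q a))
      (PowerSeries.coeff n (f * (PowerSeries.C (-4) * (EE ^ 3 - 1)) * GG x y t a)) t := by
  apply SS_hasDerivAt' n f _ (fun q k => xplus x y q k + a k)
  · simp [EE]
  · intro j hj
    have h := (xplus_t x y t j).add_const (a j)
    convert! h using 1
    rw [PowerSeries.coeff_C_mul, map_sub, EE_pow]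
    simp [PowerSeries.coeff_one, hj]

theorem HH_t (n : ℕ) (f : PowerSeries ℂ) :
    HasDerivAt (fun q => PowerSeries.coeff n (f * HH x y q a))
      (PowerSeries.coeff n (f * (PowerSeries.C (-4) * (EE ^ 3 - 1)) * HH x y t a)) t := by
  apply SS_hasDerivAt' n f _ (fun q k => (starRingEnd ℂ) (xplus x y q k) + (starRingEnd ℂ) (a k))
  · simp [EE]
  · intro j hj
    have h := (hasDerivAt_conj (xplus_t x y t j)).add_const ((starRingEnd ℂ) (a j))
    convert! h using 1
    rw [PowerSeries.coeff_C_mul, map_sub, EE_pow]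
    simp [PowerSeries.coeff_one, hj]
    simp only [map_ofNat]
end

end

section

theorem BB_hasDerivAt (T : PowerSeries ℂ) (K n m : ℕ) (G H : ℝ → PowerSeries ℂ) (r : ℝ)
    (V W f g : PowerSeries ℂ)
    (hG : ∀ f, HasDerivAt (fun q => PowerSeries.coeff n (f * G q)) (PowerSeries.coeff n (f * V * G r)) r)
    (hH : ∀ f, HasDerivAt (fun q => PowerSeries.coeff m (f * H q)) (PowerSeries.coeff m (f * W * H r)) r) :
    HasDerivAt (fun q => BB T K n m (G q) (H q) f g)
      (BB T K n m (G r) (H r) (f * V) g + BB T K n m (G r) (H r) f (g * W)) r := by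
  unfold BB
  rw [← Finset.sum_add_distrib]
  refine HasDerivAt.fun_sum fun ν _ => ?_
  have := (hG (f * T ^ ν)).mul (hH (g * T ^ ν))
  rw [show f * T ^ ν * V = f * V * T ^ ν by ring, show g * T ^ ν * W = g * W * T ^ ν by ring] at this
  exact this

theorem BB_sub_left (T : PowerSeries ℂ) (K n m : ℕ) (G H f f' g : PowerSeries ℂ) :
    BB T K n m G H (f - f') g = BB T K n m G H f g - BB T K n m G H f' g := by
  simp only [BB, sub_mul, map_sub, Finset.sum_sub_distrib]
theorem BB_sub_right (T : PowerSeries ℂ) (K n m : ℕ) (G H f g' g : PowerSeries ℂ) :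
    BB T K n m G H f (g - g') = BB T K n m G H f g - BB T K n m G H f g' := by
  simp only [BB, sub_mul, map_sub, mul_sub, Finset.sum_sub_distrib]
theorem BB_C_left (T : PowerSeries ℂ) (K n m : ℕ) (G H f g : PowerSeries ℂ) (c : ℂ) :
    BB T K n m G H (PowerSeries.C c * f) g = c * BB T K n m G H f g := by
  simp only [BB, mul_assoc, PowerSeries.coeff_C_mul, Finset.mul_sum]
theorem BB_C_right (T : PowerSeries ℂ) (K n m : ℕ) (G H f g : PowerSeries ℂ) (c : ℂ) :
    BB T K n m G H f (PowerSeries.C c * g) = c * BB T K n m G H f g := by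
  simp only [BB, mul_assoc, PowerSeries.coeff_C_mul, Finset.mul_sum]
  refine Finset.sum_congr rfl fun ν _ => ?_
  ring

section
variable {N : ℕ} (n : Fin N → ℕ) (a : Fin N → ℕ → ℂ) (s : ℕ → ℝ)

noncomputable def mm (x y t : ℝ) : Matrix (Fin N) (Fin N) ℂ :=
  Matrix.of fun i j => BB (TT s) (∑ i, n i + 1) (n i) (n j) (GG x y t (a i)) (HH x y t (a j)) 1 1
noncomputable def phi (k : ℕ) (x y t : ℝ) (i : Fin N) : ℂ :=
  PowerSeries.coeff (n i) ((EE + 1) * EE ^ k * GG x y t (a i))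
noncomputable def psi (k : ℕ) (x y t : ℝ) (i : Fin N) : ℂ :=
  PowerSeries.coeff (n i) ((EE + 1) * EE ^ k * HH x y t (a i))

theorem n_lt (i : Fin N) : n i < ∑ i, n i + 1 :=
  Nat.lt_succ_of_le (Finset.single_le_sum (f := n) (fun _ _ => Nat.zero_le _) (Finset.mem_univ i))

theorem tau_eq (x y t : ℝ) : tau N n a s x y t = (mm n a s x y t).det := by
  unfold tau
  congr 1
  ext i j
  simp only [Matrix.of_apply, mm, BB]
  have hle : min (n i) (n j) + 1 ≤ ∑ i, n i + 1 := by
    have := n_lt n i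
    omega
  rw [← Finset.sum_subset (Finset.range_mono hle)]
  · refine Finset.sum_congr rfl fun ν hν => ?_
    have hν : ν ≤ n i ∧ ν ≤ n j := by
      have := Finset.mem_range.1 hν; omega
    rw [one_mul, GG, HH, coeff_TT, coeff_TT, if_pos hν.1, if_pos hν.2]
    have e : ((4:ℂ)⁻¹) ^ ν = (1/2) ^ ν * (1/2) ^ ν := by
      rw [← mul_pow]; norm_num
    rw [e]
    have e1 : (fun k => xplus x y t k + (ν : ℂ) * (s k : ℂ) + a i k)
      = (fun k => xplus x y t k + a i k + (ν : ℂ) * (s k : ℂ)) := by ext k; ring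
    have e2 : (fun k => (starRingEnd ℂ) (xplus x y t k) + (ν : ℂ) * (s k : ℂ)
              + (starRingEnd ℂ) (a j k))
      = (fun k => (starRingEnd ℂ) (xplus x y t k) + (starRingEnd ℂ) (a j k) + (ν : ℂ) * (s k : ℂ)) := by
      ext k; ring
    rw [e1, e2]; ring
  · intro ν _ hν
    have hν : ¬ (ν ≤ n i) ∨ ¬ (ν ≤ n j) := by
      simp only [Finset.mem_range] at hν; omega
    rw [one_mul, GG, HH, coeff_TT, coeff_TT]
    rcases hν with h | h <;> simp [h]

noncomputable def bb (i j : Fin N) (x y t : ℝ) (k l : ℕ) : ℂ :=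
  BB (TT s) (∑ i, n i + 1) (n i) (n j) (GG x y t (a i)) (HH x y t (a j)) (EE ^ k) (EE ^ l)

theorem bb_rel (hs : IsSCoeffs s) (i j : Fin N) (x y t : ℝ) (k l : ℕ) :
    bb n a s i j x y t (k+1) l + bb n a s i j x y t k (l+1) =
      1/2 * phi n a k x y t i * psi n a l x y t j := by
  have := BB_rel (TT s) EE (∑ i, n i + 1) (n i) (n j) (GG x y t (a i)) (HH x y t (a j)) (EE ^ k) (EE ^ l)
    (TT_dvd s) (TT_rel s hs) (n_lt n i)
  unfold bb phi psi
  rw [pow_succ', pow_succ']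
  exact this

theorem mm_apply (x y t : ℝ) (i j : Fin N) : mm n a s x y t i j = bb n a s i j x y t 0 0 := by
  simp [mm, bb]

theorem mm_x (hs : IsSCoeffs s) (x y t : ℝ) (i j : Fin N) :
    HasDerivAt (fun q => mm n a s q y t i j)
      (1/2 * (phi n a 0 x y t i * psi n a 0 x y t j) - 2 * mm n a s x y t i j) x := by
  have h := BB_hasDerivAt (TT s) (∑ i, n i + 1) (n i) (n j) (fun q => GG q y t (a i))
    (fun q => HH q y t (a j)) x (EE - 1) (EE - 1) 1 1 (fun f => GG_x x y t (a i) (n i) f)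
    (fun f => HH_x x y t (a j) (n j) f)
  rw [one_mul, BB_sub_left, BB_sub_right] at h
  refine h.congr_deriv ?_
  have r := bb_rel n a s hs i j x y t 0 0
  rw [mm_apply]
  unfold bb at *
  simp only [zero_add, pow_one, pow_zero] at *
  linear_combination r

theorem mm_y (hs : IsSCoeffs s) (x y t : ℝ) (i j : Fin N) :
    HasDerivAt (fun q => mm n a s x q t i j)
      (I/2 * (phi n a 1 x y t i * psi n a 0 x y t j - phi n a 0 x y t i * psi n a 1 x y t j)) y := by
  have h := BB_hasDerivAt (TT s) (∑ i, n i + 1) (n i) (n j) (fun q => GG x q t (a i))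
    (fun q => HH x q t (a j)) y _ _ 1 1 (fun f => GG_y x y t (a i) (n i) f)
    (fun f => HH_y x y t (a j) (n j) f)
  rw [one_mul, one_mul, BB_C_left, BB_C_right, BB_sub_left, BB_sub_right] at h
  refine h.congr_deriv ?_
  have r := bb_rel n a s hs i j x y t 1 0
  have r2 := bb_rel n a s hs i j x y t 0 1
  unfold bb at *
  simp only [zero_add, pow_one, pow_zero, one_add_one_eq_two] at *
  linear_combination I * r - I * r2

theorem mm_t (hs : IsSCoeffs s) (x y t : ℝ) (i j : Fin N) :
    HasDerivAt (fun q => mm n a s x y q i j)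
      (-2 * (phi n a 2 x y t i * psi n a 0 x y t j - phi n a 1 x y t i * psi n a 1 x y t j
        + phi n a 0 x y t i * psi n a 2 x y t j) + 8 * mm n a s x y t i j) t := by
  have h := BB_hasDerivAt (TT s) (∑ i, n i + 1) (n i) (n j) (fun q => GG x y q (a i))
    (fun q => HH x y q (a j)) t _ _ 1 1 (fun f => GG_t x y t (a i) (n i) f)
    (fun f => HH_t x y t (a j) (n j) f)
  rw [one_mul, BB_C_left, BB_C_right, BB_sub_left, BB_sub_right] at h
  refine h.congr_deriv ?_
  have r := bb_rel n a s hs i j x y t 2 0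
  have r2 := bb_rel n a s hs i j x y t 1 1
  have r3 := bb_rel n a s hs i j x y t 0 2
  rw [mm_apply]
  unfold bb at *
  simp only [zero_add, pow_one, pow_zero, one_add_one_eq_two, show 2 + 1 = 3 from rfl] at *
  linear_combination -4 * r + 4 * r2 - 4 * r3

theorem phi_x (k : ℕ) (x y t : ℝ) (i : Fin N) :
    HasDerivAt (fun q => phi n a k q y t i) (phi n a (k+1) x y t i - phi n a k x y t i) x := by
  refine (GG_x x y t (a i) (n i) ((EE + 1) * EE ^ k)).congr_deriv ?_
  unfold phi
  rw [← map_sub]; congr 1; ring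
theorem psi_x (k : ℕ) (x y t : ℝ) (i : Fin N) :
    HasDerivAt (fun q => psi n a k q y t i) (psi n a (k+1) x y t i - psi n a k x y t i) x := by
  refine (HH_x x y t (a i) (n i) ((EE + 1) * EE ^ k)).congr_deriv ?_
  unfold psi
  rw [← map_sub]; congr 1; ring
theorem phi_y (k : ℕ) (x y t : ℝ) (i : Fin N) :
    HasDerivAt (fun q => phi n a k x q t i) (I * (phi n a (k+2) x y t i - phi n a k x y t i)) y := by
  refine (GG_y x y t (a i) (n i) ((EE + 1) * EE ^ k)).congr_deriv ?_
  unfold phi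
  rw [← map_sub, ← PowerSeries.coeff_C_mul]; congr 1; ring
theorem psi_y (k : ℕ) (x y t : ℝ) (i : Fin N) :
    HasDerivAt (fun q => psi n a k x q t i) (-I * (psi n a (k+2) x y t i - psi n a k x y t i)) y := by
  refine (HH_y x y t (a i) (n i) ((EE + 1) * EE ^ k)).congr_deriv ?_
  unfold psi
  rw [← map_sub, ← PowerSeries.coeff_C_mul]; congr 1; ring
theorem phi_t (k : ℕ) (x y t : ℝ) (i : Fin N) :
    HasDerivAt (fun q => phi n a k x y q i) (-4 * (phi n a (k+3) x y t i - phi n a k x y t i)) t := by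
  refine (GG_t x y t (a i) (n i) ((EE + 1) * EE ^ k)).congr_deriv ?_
  unfold phi
  rw [← map_sub, ← PowerSeries.coeff_C_mul]; congr 1; ring
theorem psi_t (k : ℕ) (x y t : ℝ) (i : Fin N) :
    HasDerivAt (fun q => psi n a k x y q i) (-4 * (psi n a (k+3) x y t i - psi n a k x y t i)) t := by
  refine (HH_t x y t (a i) (n i) ((EE + 1) * EE ^ k)).congr_deriv ?_
  unfold psi
  rw [← map_sub, ← PowerSeries.coeff_C_mul]; congr 1; ring

/-! conjugation symmetry -/
theorem schurS_conj (k : ℕ) (w : ℕ → ℂ) :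
    (starRingEnd ℂ) (schurS k w) = schurS k (fun j => (starRingEnd ℂ) (w j)) := by
  unfold schurS
  rw [map_sum]
  refine Finset.sum_congr rfl fun p _ => ?_
  rw [map_prod]
  refine Finset.prod_congr rfl fun i _ => ?_
  simp

theorem GG_conj (x y t : ℝ) (a : ℕ → ℂ) :
    PowerSeries.map (starRingEnd ℂ) (GG x y t a) = HH x y t a := by
  ext k
  simp only [GG, HH, SS, PowerSeries.coeff_map, PowerSeries.coeff_mk, schurS_conj, map_add]

theorem TT_conj (s : ℕ → ℝ) : PowerSeries.map (starRingEnd ℂ) (TT s) = TT s := by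
  unfold TT
  rw [map_mul, map_mul]
  congr 1
  · rw [PowerSeries.map_C]; congr 1; simp [map_ofNat]
  · congr 1
    · simp
    · ext k
      simp only [SS, PowerSeries.coeff_map, PowerSeries.coeff_mk, schurS_conj, Complex.conj_ofReal]

theorem EE_conj : PowerSeries.map (starRingEnd ℂ) EE = EE := by
  unfold EE; simp

theorem phi_conj (k : ℕ) (x y t : ℝ) (i : Fin N) :
    (starRingEnd ℂ) (phi n a k x y t i) = psi n a k x y t i := by
  unfold phi psi
  rw [← PowerSeries.coeff_map]
  simp only [map_mul, map_add, map_pow, map_one, EE_conj, GG_conj]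

noncomputable def AA (x y t : ℝ) : Matrix (Fin N) (Fin (∑ i, n i + 1)) ℂ :=
  Matrix.of fun i ν => PowerSeries.coeff (n i) (1 * TT s ^ (ν : ℕ) * GG x y t (a i))

theorem mm_gram (x y t : ℝ) : mm n a s x y t = AA n a s x y t * (AA n a s x y t).conjTranspose := by
  ext i j
  simp only [mm, BB, Matrix.of_apply, Matrix.mul_apply, Matrix.conjTranspose_apply, AA]
  rw [Finset.sum_range]
  refine Finset.sum_congr rfl fun ν _ => ?_
  congr 1
  rw [← starRingEnd_apply, ← PowerSeries.coeff_map]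
  simp only [map_mul, map_pow, map_one, TT_conj, GG_conj]

open scoped ComplexOrder in
theorem tau_pos (x y t : ℝ) (h : tau N n a s x y t ≠ 0) : 0 < tau N n a s x y t := by
  have : (mm n a s x y t).PosSemidef := by
    rw [mm_gram]; exact Matrix.posSemidef_self_mul_conjTranspose _
  have := this.det_nonneg
  rw [← tau_eq] at this
  exact lt_of_le_of_ne this h.symm

theorem mm_herm (x y t : ℝ) : (mm n a s x y t).conjTranspose = mm n a s x y t := by
  rw [mm_gram]; simp
end

end

section
open Matrix

theorem hasDerivAt_det {N : ℕ} (M : ℝ → Matrix (Fin N) (Fin N) ℂ) (M' : Matrix (Fin N) (Fin N) ℂ) (r : ℝ)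
    (h : ∀ i j, HasDerivAt (fun q => M q i j) (M' i j) r) :
    HasDerivAt (fun q => (M q).det) ((M r).adjugate * M').trace r := by
  have h1 : HasDerivAt (fun q => (M q).det)
      (∑ i, ((M r).updateRow i (M' i)).det) r := by
    have e : ∀ q, (M q).det = ∑ σ : Equiv.Perm (Fin N), ((Equiv.Perm.sign σ : ℤ) : ℂ) * ∏ i, M q i (σ i) := by
      intro q
      rw [← Matrix.det_transpose, Matrix.det_apply']; rfl
    have e2 : ∀ i, ((M r).updateRow i (M' i)).det = ∑ σ : Equiv.Perm (Fin N),
        ((Equiv.Perm.sign σ : ℤ) : ℂ) * ((∏ j ∈ Finset.univ.erase i, M r j (σ j)) * M' i (σ i)) := by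
      intro i
      rw [← Matrix.det_transpose, Matrix.det_apply']
      refine Finset.sum_congr rfl fun σ _ => ?_
      congr 1
      rw [← Finset.prod_erase_mul _ _ (Finset.mem_univ i)]
      congr 1
      · refine Finset.prod_congr rfl fun j hj => ?_
        simp [Matrix.updateRow_ne (Finset.ne_of_mem_erase hj)]
      · simp
    simp_rw [e, e2]
    rw [Finset.sum_comm]
    refine HasDerivAt.fun_sum fun σ _ => ?_
    rw [← Finset.mul_sum]
    refine HasDerivAt.const_mul _ ?_
    have := HasDerivAt.fun_finsetProd (u := Finset.univ) (fun i _ => h i (σ i))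
    simpa using this
  refine h1.congr_deriv ?_
  rw [Matrix.trace_mul_comm]
  simp only [Matrix.trace, Matrix.diag, Matrix.mul_apply]
  refine Finset.sum_congr rfl fun i _ => ?_
  have e : ∀ b : Fin N → ℂ, ((M r).updateRow i b).det = Matrix.cramer (M r)ᵀ b i := fun b => by
    rw [Matrix.cramer_transpose_apply]
  have e2 : M' i = ∑ j, M' i j • (Pi.single j 1 : Fin N → ℂ) := by
    ext k; simp [Finset.sum_apply, Pi.single_apply]
  rw [e]
  conv_lhs => rw [e2]
  rw [map_sum, Finset.sum_apply]
  refine Finset.sum_congr rfl fun j _ => ?_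
  rw [map_smul, Pi.smul_apply, smul_eq_mul, Matrix.adjugate_apply, e]

theorem differentiable_inv {N : ℕ} (M : ℝ → Matrix (Fin N) (Fin N) ℂ) (r : ℝ)
    (h : ∀ i j, DifferentiableAt ℝ (fun q => M q i j) r) (hd : (M r).det ≠ 0) (i j : Fin N) :
    DifferentiableAt ℝ (fun q => (M q)⁻¹ i j) r := by
  have hdet : ∀ A : ℝ → Matrix (Fin N) (Fin N) ℂ, (∀ i j, DifferentiableAt ℝ (fun q => A q i j) r) →
      DifferentiableAt ℝ (fun q => (A q).det) r := by
    intro A hA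
    exact (hasDerivAt_det A (Matrix.of fun i j => deriv (fun q => A q i j) r) r
      (fun i j => (hA i j).hasDerivAt)).differentiableAt
  have e : (fun q => (M q)⁻¹ i j) = fun q => ((M q).det)⁻¹ * (M q).adjugate i j := by
    ext q; rw [Matrix.inv_def]; simp
  rw [e]
  refine DifferentiableAt.fun_mul ((hdet M h).inv hd) ?_
  simp only [Matrix.adjugate_apply]
  apply hdet
  intro k l
  by_cases hk : k = j
  · subst hk; simp
  · simpa [Matrix.updateRow_ne hk] using h k l

theorem hasDerivAt_matInv {N : ℕ} (M : ℝ → Matrix (Fin N) (Fin N) ℂ) (M' : Matrix (Fin N) (Fin N) ℂ) (r : ℝ)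
    (h : ∀ i j, HasDerivAt (fun q => M q i j) (M' i j) r) (hd : (M r).det ≠ 0) (i j : Fin N) :
    HasDerivAt (fun q => (M q)⁻¹ i j) (-((M r)⁻¹ * M' * (M r)⁻¹) i j) r := by
  have hD := differentiable_inv M r (fun i j => (h i j).differentiableAt) hd
  set R' : Matrix (Fin N) (Fin N) ℂ := Matrix.of fun i j => deriv (fun q => (M q)⁻¹ i j) r with hR'
  have hR : ∀ i j, HasDerivAt (fun q => (M q)⁻¹ i j) (R' i j) r := fun i j => (hD i j).hasDerivAt
  have hdc : ContinuousAt (fun q => (M q).det) r := (hasDerivAt_det M M' r h).continuousAt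
  have hne : ∀ᶠ q in nhds r, (M q).det ≠ 0 := hdc.eventually_ne hd
  have hmul : R' * M r + (M r)⁻¹ * M' = 0 := by
    ext k l
    have h1 : HasDerivAt (fun q => ((M q)⁻¹ * M q) k l) ((R' * M r + (M r)⁻¹ * M') k l) r := by
      simp only [Matrix.mul_apply, Matrix.add_apply, ← Finset.sum_add_distrib]
      exact HasDerivAt.fun_sum fun p _ => (hR k p).mul (h p l)
    have h2 : HasDerivAt (fun q => ((M q)⁻¹ * M q) k l) 0 r := by
      refine (hasDerivAt_const r ((1 : Matrix (Fin N) (Fin N) ℂ) k l)).congr_of_eventuallyEq ?_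
      filter_upwards [hne] with q hq
      rw [Matrix.nonsing_inv_mul _ (isUnit_iff_ne_zero.2 hq)]
    exact h1.unique h2
  have hfin : R' = -((M r)⁻¹ * M' * (M r)⁻¹) := by
    have : R' * M r = -((M r)⁻¹ * M') := eq_neg_of_add_eq_zero_left hmul
    have h3 := congrArg (· * (M r)⁻¹) this
    simp only [Matrix.mul_assoc, Matrix.mul_nonsing_inv _ (isUnit_iff_ne_zero.2 hd), Matrix.mul_one, neg_mul] at h3
    rw [h3, Matrix.mul_assoc]
  have := hR i j
  rw [hfin] at this
  exact this

/-- the bilinear form. -/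
noncomputable def bil {N : ℕ} (R : Matrix (Fin N) (Fin N) ℂ) (u v : Fin N → ℂ) : ℂ :=
  ∑ i, ∑ j, u i * R i j * v j

theorem hasDerivAt_bil {N : ℕ} (M : ℝ → Matrix (Fin N) (Fin N) ℂ) (M' : Matrix (Fin N) (Fin N) ℂ) (r : ℝ)
    (u v : ℝ → Fin N → ℂ) (u' v' : Fin N → ℂ)
    (h : ∀ i j, HasDerivAt (fun q => M q i j) (M' i j) r) (hd : (M r).det ≠ 0)
    (hu : ∀ i, HasDerivAt (fun q => u q i) (u' i) r) (hv : ∀ i, HasDerivAt (fun q => v q i) (v' i) r) :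
    HasDerivAt (fun q => bil (M q)⁻¹ (u q) (v q))
      (bil (M r)⁻¹ u' (v r) + bil (M r)⁻¹ (u r) v' - bil ((M r)⁻¹ * M' * (M r)⁻¹) (u r) (v r)) r := by
  unfold bil
  simp only [← Finset.sum_add_distrib, ← Finset.sum_sub_distrib]
  refine HasDerivAt.fun_sum fun i _ => HasDerivAt.fun_sum fun j _ => ?_
  refine (((hu i).fun_mul (hasDerivAt_matInv M M' r h hd i j)).fun_mul (hv j)).congr_deriv ?_
  ring

theorem bil_eq {N : ℕ} (R : Matrix (Fin N) (Fin N) ℂ) (u v : Fin N → ℂ) : bil R u v = u ⬝ᵥ (R *ᵥ v) := by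
  simp only [bil, dotProduct, Matrix.mulVec, Finset.mul_sum, mul_assoc]

theorem bil_rank1 {N : ℕ} (R : Matrix (Fin N) (Fin N) ℂ) (u v p q : Fin N → ℂ) :
    bil (R * Matrix.vecMulVec p q * R) u v = bil R u p * bil R q v := by
  rw [bil_eq, bil_eq, bil_eq, Matrix.mul_assoc, ← Matrix.mulVec_mulVec, ← Matrix.mulVec_mulVec,
    Matrix.vecMulVec_mulVec]
  simp [Matrix.mulVec_smul, mul_comm]

theorem bil_add_mat {N : ℕ} (R S : Matrix (Fin N) (Fin N) ℂ) (u v : Fin N → ℂ) :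
    bil (R + S) u v = bil R u v + bil S u v := by
  simp only [bil, Matrix.add_apply, mul_add, add_mul, Finset.sum_add_distrib]
theorem bil_smul_mat {N : ℕ} (c : ℂ) (R : Matrix (Fin N) (Fin N) ℂ) (u v : Fin N → ℂ) :
    bil (c • R) u v = c * bil R u v := by
  simp only [bil, Matrix.smul_apply, Finset.mul_sum, smul_eq_mul]
  refine Finset.sum_congr rfl fun i _ => Finset.sum_congr rfl fun j _ => by ring
theorem bil_comb_left {N : ℕ} (R : Matrix (Fin N) (Fin N) ℂ) (c : ℂ) (u u' v : Fin N → ℂ) :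
    bil R (fun i => c * (u i - u' i)) v = c * (bil R u v - bil R u' v) := by
  simp only [bil, ← Finset.sum_sub_distrib, Finset.mul_sum]
  refine Finset.sum_congr rfl fun i _ => Finset.sum_congr rfl fun j _ => by ring
theorem bil_comb_right {N : ℕ} (R : Matrix (Fin N) (Fin N) ℂ) (c : ℂ) (u v v' : Fin N → ℂ) :
    bil R u (fun i => c * (v i - v' i)) = c * (bil R u v - bil R u v') := by
  simp only [bil, ← Finset.sum_sub_distrib, Finset.mul_sum]
  refine Finset.sum_congr rfl fun i _ => Finset.sum_congr rfl fun j _ => by ring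

end

section

section
variable {N : ℕ} (n : Fin N → ℕ) (a : Fin N → ℕ → ℂ) (s : ℕ → ℝ)

noncomputable def hh (j k : ℕ) (x y t : ℝ) : ℂ :=
  1/2 * bil (mm n a s x y t)⁻¹ (psi n a j x y t) (phi n a k x y t)

theorem bil_sandwich (M : Matrix (Fin N) (Fin N) ℂ) (hd : M.det ≠ 0) (u v : Fin N → ℂ) :
    bil (M⁻¹ * M * M⁻¹) u v = bil M⁻¹ u v := by
  rw [Matrix.nonsing_inv_mul _ (isUnit_iff_ne_zero.2 hd), Matrix.one_mul]

theorem hh_x (hs : IsSCoeffs s) (x y t : ℝ) (hτ : tau N n a s x y t ≠ 0) (j k : ℕ) :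
    HasDerivAt (fun q => hh n a s j k q y t)
      (hh n a s (j+1) k x y t + hh n a s j (k+1) x y t - hh n a s j 0 x y t * hh n a s 0 k x y t) x := by
  rw [tau_eq] at hτ
  have h := hasDerivAt_bil (fun q => mm n a s q y t)
    ((1/2 : ℂ) • Matrix.vecMulVec (phi n a 0 x y t) (psi n a 0 x y t) + (-2 : ℂ) • mm n a s x y t) x
    (fun q => psi n a j q y t) (fun q => phi n a k q y t)
    (fun i => 1 * (psi n a (j+1) x y t i - psi n a j x y t i))
    (fun i => 1 * (phi n a (k+1) x y t i - phi n a k x y t i))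
    (fun p q => (mm_x n a s hs x y t p q).congr_deriv (by
      simp [Matrix.vecMulVec_apply]; ring)) hτ
    (fun i => (psi_x n a j x y t i).congr_deriv (by ring))
    (fun i => (phi_x n a k x y t i).congr_deriv (by ring))
  refine (h.const_mul (1/2 : ℂ)).congr_deriv ?_
  simp only [Matrix.mul_add, Matrix.add_mul, Matrix.mul_smul, Matrix.smul_mul, bil_add_mat, bil_smul_mat,
    bil_rank1, bil_sandwich _ hτ, bil_comb_left, bil_comb_right, hh]
  ring

theorem hh_y (hs : IsSCoeffs s) (x y t : ℝ) (hτ : tau N n a s x y t ≠ 0) (j k : ℕ) :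
    HasDerivAt (fun q => hh n a s j k x q t)
      (I * (hh n a s j (k+2) x y t - hh n a s (j+2) k x y t
        - hh n a s j 1 x y t * hh n a s 0 k x y t + hh n a s j 0 x y t * hh n a s 1 k x y t)) y := by
  rw [tau_eq] at hτ
  have h := hasDerivAt_bil (fun q => mm n a s x q t)
    ((I/2 : ℂ) • Matrix.vecMulVec (phi n a 1 x y t) (psi n a 0 x y t)
      + (-I/2 : ℂ) • Matrix.vecMulVec (phi n a 0 x y t) (psi n a 1 x y t)) y
    (fun q => psi n a j x q t) (fun q => phi n a k x q t)
    (fun i => -I * (psi n a (j+2) x y t i - psi n a j x y t i))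
    (fun i => I * (phi n a (k+2) x y t i - phi n a k x y t i))
    (fun p q => (mm_y n a s hs x y t p q).congr_deriv (by
      simp [Matrix.vecMulVec_apply]; ring)) hτ
    (fun i => psi_y n a j x y t i)
    (fun i => phi_y n a k x y t i)
  refine (h.const_mul (1/2 : ℂ)).congr_deriv ?_
  simp only [Matrix.mul_add, Matrix.add_mul, Matrix.mul_smul, Matrix.smul_mul, bil_add_mat, bil_smul_mat,
    bil_rank1, bil_sandwich _ hτ, bil_comb_left, bil_comb_right, hh]
  ring

theorem hh_t (hs : IsSCoeffs s) (x y t : ℝ) (hτ : tau N n a s x y t ≠ 0) (j k : ℕ) :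
    HasDerivAt (fun q => hh n a s j k x y q)
      (-4 * (hh n a s (j+3) k x y t + hh n a s j (k+3) x y t
        - hh n a s j 2 x y t * hh n a s 0 k x y t + hh n a s j 1 x y t * hh n a s 1 k x y t
        - hh n a s j 0 x y t * hh n a s 2 k x y t)) t := by
  rw [tau_eq] at hτ
  have h := hasDerivAt_bil (fun q => mm n a s x y q)
    ((-2 : ℂ) • Matrix.vecMulVec (phi n a 2 x y t) (psi n a 0 x y t)
      + (2 : ℂ) • Matrix.vecMulVec (phi n a 1 x y t) (psi n a 1 x y t)
      + (-2 : ℂ) • Matrix.vecMulVec (phi n a 0 x y t) (psi n a 2 x y t)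
      + (8 : ℂ) • mm n a s x y t) t
    (fun q => psi n a j x y q) (fun q => phi n a k x y q)
    (fun i => -4 * (psi n a (j+3) x y t i - psi n a j x y t i))
    (fun i => -4 * (phi n a (k+3) x y t i - phi n a k x y t i))
    (fun p q => (mm_t n a s hs x y t p q).congr_deriv (by
      simp [Matrix.vecMulVec_apply]; ring)) hτ
    (fun i => psi_t n a j x y t i)
    (fun i => phi_t n a k x y t i)
  refine (h.const_mul (1/2 : ℂ)).congr_deriv ?_
  simp only [Matrix.mul_add, Matrix.add_mul, Matrix.mul_smul, Matrix.smul_mul, bil_add_mat, bil_smul_mat,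
    bil_rank1, bil_sandwich _ hτ, bil_comb_left, bil_comb_right, hh]
  ring

theorem hh_conj (j k : ℕ) (x y t : ℝ) : (starRingEnd ℂ) (hh n a s j k x y t) = hh n a s k j x y t := by
  have hR : ((mm n a s x y t)⁻¹).conjTranspose = (mm n a s x y t)⁻¹ := by
    rw [Matrix.conjTranspose_nonsing_inv, mm_herm]
  have hc : ∀ k i, (starRingEnd ℂ) (psi n a k x y t i) = phi n a k x y t i := by
    intro k i; rw [← phi_conj, Complex.conj_conj]
  unfold hh bil
  simp only [map_mul, map_sum, hc, phi_conj]
  rw [Finset.sum_comm]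
  congr 1
  · simp [map_ofNat]
  refine Finset.sum_congr rfl fun i _ => Finset.sum_congr rfl fun l _ => ?_
  have : (starRingEnd ℂ) ((mm n a s x y t)⁻¹ l i) = (mm n a s x y t)⁻¹ i l := by
    conv_rhs => rw [← hR]
    rfl
  rw [this]; ring

theorem tau_x (hs : IsSCoeffs s) (x y t : ℝ) (hτ : tau N n a s x y t ≠ 0) :
    HasDerivAt (fun q => tau N n a s q y t)
      (tau N n a s x y t * (hh n a s 0 0 x y t - 2 * N)) x := by
  have h := hasDerivAt_det (fun q => mm n a s q y t)
    ((1/2 : ℂ) • Matrix.vecMulVec (phi n a 0 x y t) (psi n a 0 x y t) + (-2 : ℂ) • mm n a s x y t) x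
    (fun p q => (mm_x n a s hs x y t p q).congr_deriv (by
      simp [Matrix.vecMulVec_apply]; ring))
  simp only [tau_eq] at hτ ⊢
  refine h.congr_deriv ?_
  have hadj : (mm n a s x y t).adjugate = (mm n a s x y t).det • (mm n a s x y t)⁻¹ := by
    rw [Matrix.inv_def, smul_smul, Ring.mul_inverse_cancel _ (isUnit_iff_ne_zero.2 hτ), one_smul]
  rw [Matrix.mul_add, Matrix.trace_add, Matrix.mul_smul, Matrix.mul_smul, Matrix.adjugate_mul, hadj,
    Matrix.smul_mul, Matrix.trace_smul, Matrix.trace_smul, Matrix.trace_smul, Matrix.trace_smul,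
    Matrix.trace_one, Matrix.mul_vecMulVec, Matrix.trace_vecMulVec]
  rw [hh, bil_eq, dotProduct_comm]
  simp
  ring

theorem log_tau_x (hs : IsSCoeffs s) (x y t : ℝ) (hτ : tau N n a s x y t ≠ 0) :
    HasDerivAt (fun q => Complex.log (tau N n a s q y t)) (hh n a s 0 0 x y t - 2 * N) x := by
  have h := (tau_x n a s hs x y t hτ).clog_real (by
    have := tau_pos n a s x y t hτ
    rw [Complex.lt_def] at this
    exact Or.inl this.1)
  refine h.congr_deriv ?_
  field_simp

/-- complex version of the solution. -/
noncomputable def vv (x y t : ℝ) : ℂ :=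
  2 * (hh n a s 1 0 x y t + hh n a s 0 1 x y t - hh n a s 0 0 x y t * hh n a s 0 0 x y t)

theorem uLam_eq (hs : IsSCoeffs s) (x y t : ℝ) (hτ : tau N n a s x y t ≠ 0) :
    ((uLam N n a s x y t : ℝ) : ℂ) = vv n a s x y t := by
  have hne : ∀ᶠ q in nhds x, tau N n a s q y t ≠ 0 :=
    (tau_x n a s hs x y t hτ).continuousAt.eventually_ne hτ
  have h2 : iteratedDeriv 2 (fun x' : ℝ => Complex.log (tau N n a s x' y t)) x =
      hh n a s 1 0 x y t + hh n a s 0 1 x y t - hh n a s 0 0 x y t * hh n a s 0 0 x y t := by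
    rw [iteratedDeriv_succ, iteratedDeriv_one]
    have : deriv (fun x' : ℝ => Complex.log (tau N n a s x' y t)) =ᶠ[nhds x]
        fun q => hh n a s 0 0 q y t - 2 * N := by
      filter_upwards [hne] with q hq
      exact (log_tau_x n a s hs q y t hq).deriv
    rw [this.deriv_eq]
    exact ((hh_x n a s hs x y t hτ 0 0).sub_const _).deriv
  unfold uLam
  rw [h2]
  change (((vv n a s x y t).re : ℝ) : ℂ) = _
  rw [← Complex.conj_eq_iff_re]
  unfold vv
  simp only [map_mul, map_sub, map_add, hh_conj, map_ofNat]
  ring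
end

end

section

section
open MvPolynomial

noncomputable def Dx : Derivation ℂ (MvPolynomial (ℕ × ℕ) ℂ) (MvPolynomial (ℕ × ℕ) ℂ) :=
  mkDerivation ℂ (fun p => X (p.1+1, p.2) + X (p.1, p.2+1) - X (p.1, 0) * X (0, p.2))
noncomputable def Dy : Derivation ℂ (MvPolynomial (ℕ × ℕ) ℂ) (MvPolynomial (ℕ × ℕ) ℂ) :=
  mkDerivation ℂ (fun p => C I * (X (p.1, p.2+2) - X (p.1+2, p.2) - X (p.1, 1) * X (0, p.2)
    + X (p.1, 0) * X (1, p.2)))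
noncomputable def Dt : Derivation ℂ (MvPolynomial (ℕ × ℕ) ℂ) (MvPolynomial (ℕ × ℕ) ℂ) :=
  mkDerivation ℂ (fun p => -4 * (X (p.1+3, p.2) + X (p.1, p.2+3) - X (p.1, 2) * X (0, p.2)
    + X (p.1, 1) * X (1, p.2) - X (p.1, 0) * X (2, p.2)))

theorem Dx_X (j k : ℕ) : Dx (X (j, k)) = X (j+1, k) + X (j, k+1) - X (j, 0) * X (0, k) :=
  mkDerivation_X _ _ _
theorem Dy_X (j k : ℕ) : Dy (X (j, k)) = C I * (X (j, k+2) - X (j+2, k) - X (j, 1) * X (0, k)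
    + X (j, 0) * X (1, k)) := mkDerivation_X _ _ _
theorem Dt_X (j k : ℕ) : Dt (X (j, k)) = -4 * (X (j+3, k) + X (j, k+3) - X (j, 2) * X (0, k)
    + X (j, 1) * X (1, k) - X (j, 0) * X (2, k)) := mkDerivation_X _ _ _

theorem D_ofNat (D : Derivation ℂ (MvPolynomial (ℕ × ℕ) ℂ) (MvPolynomial (ℕ × ℕ) ℂ)) (m : ℕ) [m.AtLeastTwo] :
    D (OfNat.ofNat m : MvPolynomial (ℕ × ℕ) ℂ) = 0 := by
  have := D.map_natCast m
  exact_mod_cast this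

theorem D_negNat (D : Derivation ℂ (MvPolynomial (ℕ × ℕ) ℂ) (MvPolynomial (ℕ × ℕ) ℂ)) :
    D (-4 : MvPolynomial (ℕ × ℕ) ℂ) = 0 := by
  rw [map_neg, D_ofNat, neg_zero]

theorem D2 (D : Derivation ℂ (MvPolynomial (ℕ × ℕ) ℂ) (MvPolynomial (ℕ × ℕ) ℂ)) :
    D (2 : MvPolynomial (ℕ × ℕ) ℂ) = 0 := D_ofNat D 2
theorem D3 (D : Derivation ℂ (MvPolynomial (ℕ × ℕ) ℂ) (MvPolynomial (ℕ × ℕ) ℂ)) :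
    D (3 : MvPolynomial (ℕ × ℕ) ℂ) = 0 := D_ofNat D 3
theorem D6 (D : Derivation ℂ (MvPolynomial (ℕ × ℕ) ℂ) (MvPolynomial (ℕ × ℕ) ℂ)) :
    D (6 : MvPolynomial (ℕ × ℕ) ℂ) = 0 := D_ofNat D 6

theorem Dxy (P : MvPolynomial (ℕ × ℕ) ℂ) : Dx (Dy P) = Dy (Dx P) := by
  have : ⁅Dx, Dy⁆ = 0 := by
    apply MvPolynomial.derivation_ext
    rintro ⟨j, k⟩
    rw [Derivation.commutator_apply]
    simp only [Dx_X, Dy_X, Derivation.leibniz, map_add, map_sub, smul_eq_mul, derivation_C,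
      Derivation.zero_apply]
    ring
  have h := congrArg (fun D => D P) this
  simp only [Derivation.commutator_apply, Derivation.zero_apply] at h
  exact sub_eq_zero.1 h

theorem Dxt (P : MvPolynomial (ℕ × ℕ) ℂ) : Dx (Dt P) = Dt (Dx P) := by
  have : ⁅Dx, Dt⁆ = 0 := by
    apply MvPolynomial.derivation_ext
    rintro ⟨j, k⟩
    rw [Derivation.commutator_apply]
    simp only [Dx_X, Dt_X, Derivation.leibniz, map_add, map_sub, smul_eq_mul, D_negNat,
      Derivation.zero_apply]
    ring
  have h := congrArg (fun D => D P) this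
  simp only [Derivation.commutator_apply, Derivation.zero_apply] at h
  exact sub_eq_zero.1 h

theorem pot_KP : Dx (Dt (X (0,0)) + 6 * Dx (X (0,0)) * Dx (X (0,0)) + Dx (Dx (Dx (X (0,0)))))
    = 3 * Dy (Dy (X (0,0))) := by
  have hI : (C I * C I : MvPolynomial (ℕ × ℕ) ℂ) = -1 := by
    rw [← C_mul, Complex.I_mul_I]; simp
  simp only [Dx_X, Dy_X, Dt_X, Derivation.leibniz, map_add, map_sub, smul_eq_mul, derivation_C,
      D_negNat, D6, zero_add, Nat.reduceAdd]
  linear_combination (3*(-X (4,0) + X (3,0)*X (0,0) + X (0,0)*X (0,3) + 2*X (0,0)*X (1,0)*X (0,1) - 2*X (0,0)*X (1,0)^2 - 2*X (0,0)*X (0,1)^2 -2*X (0,0)*X (1,2) -2*X (0,0)*X (2,1) +2*X (0,0)^2*X (1,1) - X (0,4) - X (0,2)*X (1,0) + 2*X (0,2)*X (0,1) +2*X (1,0)*X (2,0) - X (0,1)*X (2,0) + 2*X (2,2))) * hI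

theorem poly_KP (u : MvPolynomial (ℕ × ℕ) ℂ) (hu : u = 2 * Dx (X (0,0))) :
    Dx (Dt u + 6 * u * Dx u + Dx (Dx (Dx u))) - 3 * Dy (Dy u) = 0 := by
  have h := congrArg (fun P => 2 * Dx P) pot_KP
  subst hu
  simp only [Derivation.leibniz, map_add, smul_eq_mul, D2, D3, D6, ← Dxy, ← Dxt, mul_zero, add_zero] at h ⊢
  linear_combination h
end

section
open MvPolynomial
theorem hasDerivAt_aeval (D : Derivation ℂ (MvPolynomial (ℕ × ℕ) ℂ) (MvPolynomial (ℕ × ℕ) ℂ))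
    (g : ℝ → ℕ × ℕ → ℂ) (r : ℝ)
    (h : ∀ p, HasDerivAt (fun q => g q p) (aeval (g r) (D (X p))) r) (P : MvPolynomial (ℕ × ℕ) ℂ) :
    HasDerivAt (fun q => aeval (g q) P) (aeval (g r) (D P)) r := by
  induction P using MvPolynomial.induction_on with
  | C c => simpa using hasDerivAt_const r c
  | add p q hp hq => simpa only [map_add] using hp.fun_add hq
  | mul_X p i hp =>
    simp only [map_mul, aeval_X]
    refine (hp.fun_mul (h i)).congr_deriv ?_
    simp only [Derivation.leibniz, smul_eq_mul, map_add, map_mul, aeval_X]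
    ring

theorem real_deriv_of (f : ℝ → ℝ) (g : ℝ → ℂ) (g' : ℂ) (r : ℝ)
    (he : ∀ᶠ q in nhds r, ((f q : ℝ) : ℂ) = g q) (hg : HasDerivAt g g' r) :
    ((deriv f r : ℝ) : ℂ) = g' := by
  have h1 : HasDerivAt (fun q => ((f q : ℝ) : ℂ)) g' r := hg.congr_of_eventuallyEq he
  have h2 : HasDerivAt f g'.re r := by
    have := Complex.reCLM.hasFDerivAt.comp_hasDerivAt r h1
    simpa [Function.comp_def] using this
  rw [h2.deriv]
  exact h2.ofReal_comp.unique h1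

variable {N : ℕ} (n : Fin N → ℕ) (a : Fin N → ℕ → ℂ) (s : ℕ → ℝ)

noncomputable def ev (x y t : ℝ) (P : MvPolynomial (ℕ × ℕ) ℂ) : ℂ :=
  aeval (fun p : ℕ × ℕ => hh n a s p.1 p.2 x y t) P

theorem tau_y_ev (hs : IsSCoeffs s) (x y t : ℝ) (hτ : tau N n a s x y t ≠ 0) :
    ∀ᶠ q in nhds y, tau N n a s x q t ≠ 0 := by
  simp only [tau_eq] at hτ ⊢
  exact (hasDerivAt_det (fun q => mm n a s x q t) (Matrix.of fun i j => _) y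
    (fun p q => mm_y n a s hs x y t p q)).continuousAt.eventually_ne hτ
theorem tau_t_ev (hs : IsSCoeffs s) (x y t : ℝ) (hτ : tau N n a s x y t ≠ 0) :
    ∀ᶠ q in nhds t, tau N n a s x y q ≠ 0 := by
  simp only [tau_eq] at hτ ⊢
  exact (hasDerivAt_det (fun q => mm n a s x y q) (Matrix.of fun i j => _) t
    (fun p q => mm_t n a s hs x y t p q)).continuousAt.eventually_ne hτ
theorem tau_x_ev (hs : IsSCoeffs s) (x y t : ℝ) (hτ : tau N n a s x y t ≠ 0) :
    ∀ᶠ q in nhds x, tau N n a s q y t ≠ 0 :=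
  (tau_x n a s hs x y t hτ).continuousAt.eventually_ne hτ

/-- `f` is represented by the polynomial `P` in the functions `hh`. -/
def PolyRep (f : ℝ → ℝ → ℝ → ℝ) (P : MvPolynomial (ℕ × ℕ) ℂ) : Prop :=
  ∀ x y t : ℝ, tau N n a s x y t ≠ 0 → ((f x y t : ℝ) : ℂ) = ev n a s x y t P

theorem PolyRep.dx (hs : IsSCoeffs s) {f : ℝ → ℝ → ℝ → ℝ} {P : MvPolynomial (ℕ × ℕ) ℂ} (h : PolyRep n a s f P) :
    PolyRep n a s (pdx f) (Dx P) := by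
  intro x y t hτ
  refine real_deriv_of (fun q => f q y t) (fun q => ev n a s q y t P) _ x ?_ ?_
  · filter_upwards [tau_x_ev n a s hs x y t hτ] with q hq using h q y t hq
  · refine hasDerivAt_aeval Dx (fun q p => hh n a s p.1 p.2 q y t) x ?_ P
    rintro ⟨j, k⟩
    refine (hh_x n a s hs x y t hτ j k).congr_deriv ?_
    simp [Dx_X]

theorem PolyRep.dy (hs : IsSCoeffs s) {f : ℝ → ℝ → ℝ → ℝ} {P : MvPolynomial (ℕ × ℕ) ℂ} (h : PolyRep n a s f P) :
    PolyRep n a s (pdy f) (Dy P) := by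
  intro x y t hτ
  refine real_deriv_of (fun q => f x q t) (fun q => ev n a s x q t P) _ y ?_ ?_
  · filter_upwards [tau_y_ev n a s hs x y t hτ] with q hq using h x q t hq
  · refine hasDerivAt_aeval Dy (fun q p => hh n a s p.1 p.2 x q t) y ?_ P
    rintro ⟨j, k⟩
    refine (hh_y n a s hs x y t hτ j k).congr_deriv ?_
    simp [Dy_X]

theorem PolyRep.dt (hs : IsSCoeffs s) {f : ℝ → ℝ → ℝ → ℝ} {P : MvPolynomial (ℕ × ℕ) ℂ} (h : PolyRep n a s f P) :
    PolyRep n a s (pdt f) (Dt P) := by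
  intro x y t hτ
  refine real_deriv_of (fun q => f x y q) (fun q => ev n a s x y q P) _ t ?_ ?_
  · filter_upwards [tau_t_ev n a s hs x y t hτ] with q hq using h x y q hq
  · refine hasDerivAt_aeval Dt (fun q p => hh n a s p.1 p.2 x y q) t ?_ P
    rintro ⟨j, k⟩
    refine (hh_t n a s hs x y t hτ j k).congr_deriv ?_
    simp [Dt_X]

theorem uLam_KP (hs : IsSCoeffs s) (x y t : ℝ) (hτ : tau N n a s x y t ≠ 0) :
    IsKPISolutionAt (uLam N n a s) x y t := by
  have hu : PolyRep n a s (uLam N n a s) (2 * Dx (X (0,0))) := by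
    intro x y t hτ
    rw [uLam_eq n a s hs x y t hτ]
    simp [ev, vv, Dx_X]
  have hE : PolyRep n a s (fun x y t => pdt (uLam N n a s) x y t
      + 6 * uLam N n a s x y t * pdx (uLam N n a s) x y t + pdx (pdx (pdx (uLam N n a s))) x y t)
      (Dt (2 * Dx (X (0,0))) + 6 * (2 * Dx (X (0,0))) * Dx (2 * Dx (X (0,0)))
        + Dx (Dx (Dx (2 * Dx (X (0,0)))))) := by
    intro x y t hτ
    have h1 := hu.dt n a s hs x y t hτ
    have h2 := hu.dx n a s hs x y t hτ
    have h3 := ((hu.dx n a s hs).dx n a s hs).dx n a s hs x y t hτ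
    have h0 := hu x y t hτ
    push_cast
    rw [h0, h1, h2, h3]
    simp only [ev, map_add, map_mul, map_ofNat]
  have h4 := hE.dx n a s hs x y t hτ
  have h5 := (hu.dy n a s hs).dy n a s hs x y t hτ
  unfold IsKPISolutionAt
  have h6 := congrArg (ev n a s x y t) (poly_KP _ rfl)
  simp only [ev, map_sub, map_mul, map_ofNat, map_zero] at h6 h4 h5
  apply Complex.ofReal_injective
  rw [Complex.ofReal_sub, Complex.ofReal_mul, h4, h5]
  simpa using h6
end

end

section

section
theorem an_ofReal {f : ℝ × ℝ × ℝ → ℝ} {p : ℝ × ℝ × ℝ} (h : AnalyticAt ℝ f p) :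
    AnalyticAt ℝ (fun q => ((f q : ℝ) : ℂ)) p :=
  (Complex.ofRealCLM.analyticAt (f p)).fun_comp h

theorem an_conj {f : ℝ × ℝ × ℝ → ℂ} {p : ℝ × ℝ × ℝ} (h : AnalyticAt ℝ f p) :
    AnalyticAt ℝ (fun q => (starRingEnd ℂ) (f q)) p :=
  ((Complex.conjCLE : ℂ →L[ℝ] ℂ).analyticAt (f p)).fun_comp h

theorem an_xplus (k : ℕ) (p : ℝ × ℝ × ℝ) :
    AnalyticAt ℝ (fun q : ℝ × ℝ × ℝ => xplus q.1 q.2.1 q.2.2 k) p := by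
  have h1 : AnalyticAt ℝ (fun q : ℝ × ℝ × ℝ => ((q.1 : ℝ) : ℂ)) p := an_ofReal analyticAt_fst
  have h2 : AnalyticAt ℝ (fun q : ℝ × ℝ × ℝ => ((q.2.1 : ℝ) : ℂ)) p :=
    an_ofReal (analyticAt_fst.fun_comp analyticAt_snd)
  have h3 : AnalyticAt ℝ (fun q : ℝ × ℝ × ℝ => ((q.2.2 : ℝ) : ℂ)) p :=
    an_ofReal (analyticAt_snd.fun_comp analyticAt_snd)
  unfold xplus
  simp only [div_eq_mul_inv]
  exact ((h1.fun_mul analyticAt_const).fun_add (analyticAt_const.fun_mul h2)).fun_sub (analyticAt_const.fun_mul h3)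

theorem an_schurS (k : ℕ) (w : ℝ × ℝ × ℝ → ℕ → ℂ) (p : ℝ × ℝ × ℝ)
    (h : ∀ j, AnalyticAt ℝ (fun q => w q j) p) : AnalyticAt ℝ (fun q => schurS k (w q)) p := by
  unfold schurS
  refine Finset.analyticAt_fun_sum _ fun P _ => Finset.analyticAt_fun_prod _ fun i _ => ?_
  simp only [div_eq_mul_inv]
  exact ((h i).fun_pow _).fun_mul analyticAt_const

theorem an_coeff (G : ℝ × ℝ × ℝ → PowerSeries ℂ) (f : PowerSeries ℂ) (p : ℝ × ℝ × ℝ)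
    (h : ∀ j, AnalyticAt ℝ (fun q => PowerSeries.coeff j (G q)) p) (m : ℕ) :
    AnalyticAt ℝ (fun q => PowerSeries.coeff m (f * G q)) p := by
  simp only [PowerSeries.coeff_mul]
  exact Finset.analyticAt_fun_sum _ fun P _ => analyticAt_const.fun_mul (h _)

theorem an_GG (a : ℕ → ℂ) (p : ℝ × ℝ × ℝ) (j : ℕ) :
    AnalyticAt ℝ (fun q : ℝ × ℝ × ℝ => PowerSeries.coeff j (GG q.1 q.2.1 q.2.2 a)) p := by
  simp only [GG, SS, PowerSeries.coeff_mk]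
  exact an_schurS j _ p fun k => (an_xplus k p).fun_add analyticAt_const

theorem an_HH (a : ℕ → ℂ) (p : ℝ × ℝ × ℝ) (j : ℕ) :
    AnalyticAt ℝ (fun q : ℝ × ℝ × ℝ => PowerSeries.coeff j (HH q.1 q.2.1 q.2.2 a)) p := by
  simp only [HH, SS, PowerSeries.coeff_mk]
  exact an_schurS j _ p fun k => (an_conj (an_xplus k p)).fun_add analyticAt_const

theorem an_det {N : ℕ} (M : ℝ × ℝ × ℝ → Matrix (Fin N) (Fin N) ℂ) (p : ℝ × ℝ × ℝ)
    (h : ∀ i j, AnalyticAt ℝ (fun q => M q i j) p) : AnalyticAt ℝ (fun q => (M q).det) p := by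
  simp only [Matrix.det_apply']
  exact Finset.analyticAt_fun_sum _ fun σ _ => analyticAt_const.fun_mul
    (Finset.analyticAt_fun_prod _ fun i _ => h _ _)

theorem an_inv {N : ℕ} (M : ℝ × ℝ × ℝ → Matrix (Fin N) (Fin N) ℂ) (p : ℝ × ℝ × ℝ)
    (h : ∀ i j, AnalyticAt ℝ (fun q => M q i j) p) (hd : (M p).det ≠ 0) (i j : Fin N) :
    AnalyticAt ℝ (fun q => (M q)⁻¹ i j) p := by
  have e : (fun q => (M q)⁻¹ i j) = fun q => ((M q).det)⁻¹ * (M q).adjugate i j := by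
    ext q; rw [Matrix.inv_def]; simp
  rw [e]
  refine AnalyticAt.fun_mul ((an_det M p h).fun_inv hd) ?_
  simp only [Matrix.adjugate_apply]
  apply an_det
  intro k l
  by_cases hk : k = j
  · subst hk; simpa using analyticAt_const
  · simpa [Matrix.updateRow_ne hk] using h k l

variable {N : ℕ} (n : Fin N → ℕ) (a : Fin N → ℕ → ℂ) (s : ℕ → ℝ)

theorem an_mm (p : ℝ × ℝ × ℝ) (i j : Fin N) :
    AnalyticAt ℝ (fun q : ℝ × ℝ × ℝ => mm n a s q.1 q.2.1 q.2.2 i j) p := by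
  simp only [mm, BB, Matrix.of_apply]
  exact Finset.analyticAt_fun_sum _ fun ν _ =>
    (an_coeff _ _ p (an_GG _ p) _).fun_mul (an_coeff _ _ p (an_HH _ p) _)

theorem an_hh (j k : ℕ) (p : ℝ × ℝ × ℝ) (hτ : tau N n a s p.1 p.2.1 p.2.2 ≠ 0) :
    AnalyticAt ℝ (fun q : ℝ × ℝ × ℝ => hh n a s j k q.1 q.2.1 q.2.2) p := by
  rw [tau_eq] at hτ
  unfold hh bil
  refine analyticAt_const.fun_mul (Finset.analyticAt_fun_sum _ fun i _ =>
    Finset.analyticAt_fun_sum _ fun l _ => ?_)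
  refine AnalyticAt.fun_mul (AnalyticAt.fun_mul ?_ ?_) ?_
  · exact an_coeff _ _ p (an_HH _ p) _
  · exact an_inv (fun q : ℝ × ℝ × ℝ => mm n a s q.1 q.2.1 q.2.2) p (an_mm n a s p) hτ i l
  · exact an_coeff _ _ p (an_GG _ p) _

theorem an_uLam (hs : IsSCoeffs s) (p : ℝ × ℝ × ℝ) (hτ : tau N n a s p.1 p.2.1 p.2.2 ≠ 0) :
    AnalyticAt ℝ (fun q : ℝ × ℝ × ℝ => uLam N n a s q.1 q.2.1 q.2.2) p := by
  have hv : AnalyticAt ℝ (fun q : ℝ × ℝ × ℝ => vv n a s q.1 q.2.1 q.2.2) p := by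
    unfold vv
    have h := fun j k => an_hh n a s j k p hτ
    exact analyticAt_const.fun_mul (((h 1 0).fun_add (h 0 1)).fun_sub ((h 0 0).fun_mul (h 0 0)))
  have hre : AnalyticAt ℝ (fun q : ℝ × ℝ × ℝ => (vv n a s q.1 q.2.1 q.2.2).re) p :=
    (Complex.reCLM.analyticAt _).fun_comp hv
  refine hre.congr ?_
  have hc : ContinuousAt (fun q : ℝ × ℝ × ℝ => tau N n a s q.1 q.2.1 q.2.2) p := by
    simp only [tau_eq]
    exact (an_det _ p (an_mm n a s p)).continuousAt
  filter_upwards [hc.eventually_ne hτ] with q hq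
  rw [← uLam_eq n a s hs _ _ _ hq, Complex.ofReal_re]
end

end

/-- For any index vector `Λ` of distinct positive integers and
arbitrary internal parameters, the higher-order lump `u_Λ = 2 ∂²/∂x² ln σ` is
real-analytic and satisfies the KP-I equation at every point where `σ ≠ 0`. -/
theorem higher_order_lump_solves_KPI
    (N : ℕ) (hN : 0 < N) (n : Fin N → ℕ) (hpos : ∀ i, 0 < n i)
    (hdist : Function.Injective n)
    (a : Fin N → ℕ → ℂ) (ha : ∀ i j, (j = 0 ∨ n i < j) → a i j = 0)
    (s : ℕ → ℝ) (hs : IsSCoeffs s)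
    (x y t : ℝ) (hσ : tau N n a s x y t ≠ 0) :
    AnalyticAt ℝ (fun p : ℝ × ℝ × ℝ => uLam N n a s p.1 p.2.1 p.2.2) (x, y, t) ∧
      IsKPISolutionAt (uLam N n a s) x y t := by
  exact ⟨an_uLam n a s hs (x, y, t) hσ, uLam_KP n a s hs x y t hσ⟩
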